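/- arXiv:2208.07789 — 3 statements merged into one kernel-verified Lean document; each statement's English description precedes it below -/
import Mathlib

section
/- Let S be a finite monoid, A a finite alphabet, α : A* → S a morphism, and ℓ ≥ 3 an integer. Then for every word w ∈ A* of length at least ℓ^(3|S|), there exist an idempotent e ∈ S and a factor w' of w that can be decomposed as w' = w₁w₂⋯w_ℓ, where each w_i is a nonempty word and α(w₁) = α(w₂) = ⋯ = α(w_ℓ) = e. -/
/-- `x` is a two-sided factor of `y`. -/
def SimonDvd {S : Type} [Monoid S] (x y : S) : Prop := ∃ a b, y = a * x * b

theorem SimonDvd.trans {S : Type} [Monoid S] {x y z : S} (h1 : SimonDvd x y)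
    (h2 : SimonDvd y z) : SimonDvd x z := by
  obtain ⟨a, b, rfl⟩ := h1
  obtain ⟨c, d, rfl⟩ := h2
  exact ⟨c * a, b * d, by simp only [mul_assoc]⟩

/-- Stability: if `s * y = s` and `y` is a multiple of `s`, then `y` is a left multiple of `s`. -/
theorem simon_stable {S : Type} [Monoid S] [Fintype S] {s y : S} (h : s * y = s)
    (hd : SimonDvd s y) : ∃ z, y = z * s := by
  obtain ⟨a, b, hy⟩ := hd
  have h1 : y = (a * s) * y * b := by
    rw [mul_assoc a s y, h]; exact hy
  have hn : ∀ n : ℕ, y = (a * s) ^ n * y * b ^ n := by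
    intro n
    induction n with
    | zero => simp
    | succ n ih =>
      calc y = (a * s) ^ n * y * b ^ n := ih
        _ = (a * s) ^ n * ((a * s) * y * b) * b ^ n := by rw [← h1]
        _ = _ := by rw [pow_succ, pow_succ' b]; simp only [mul_assoc]
  have key : ∀ i j : ℕ, i < j → (a * s) ^ i = (a * s) ^ j → ∃ z, y = z * s := by
    intro i j hij he
    have h2 : y = (a * s) ^ (j - i) * y := by
      calc y = (a * s) ^ j * y * b ^ i := by rw [← he]; exact hn i
        _ = (a * s) ^ (j - i) * ((a * s) ^ i * y * b ^ i) := by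
          rw [← mul_assoc, ← mul_assoc, ← pow_add]
          congr 4; omega
        _ = _ := by rw [← hn i]
    obtain ⟨d, hd⟩ : ∃ d, j - i = d + 1 := ⟨j - i - 1, by omega⟩
    refine ⟨(a * s) ^ d * a, ?_⟩
    rw [hd, pow_succ, mul_assoc, mul_assoc, h] at h2
    rw [mul_assoc]; exact h2
  obtain ⟨i, j, hne, he⟩ := Finite.exists_ne_map_eq_of_infinite (fun n : ℕ => (a * s) ^ n)
  rcases lt_or_gt_of_ne hne with h' | h'
  · exact key i j h' he
  · exact key j i h' he.symm

theorem simon_arith (l k : ℕ) (hl : 3 ≤ l) (hk : 1 ≤ k) :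
    k * (k * l + 1) < l ^ (3 * k) := by
  have h1 : k + 1 ≤ l ^ k := Nat.lt_pow_self (by omega)
  have h2 : l ≤ l ^ k := Nat.le_self_pow (by omega) l
  have : l ^ (3 * k) = l ^ k * l ^ k * l ^ k := by
    rw [← pow_add, ← pow_add]; congr 1; ring
  rw [this]
  have : (k + 1) * (k + 1) * l ≤ l ^ k * l ^ k * l ^ k := by gcongr
  nlinarith

open Classical in
/-- The regular case: all factors lie in one J-class `J`. -/
theorem simon_class {S : Type} [Monoid S] [Fintype S] (l m : ℕ)
    (g : ℕ → ℕ → S) (hg : ∀ i j k, i ≤ j → j ≤ k → g i j * g j k = g i k)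
    (J : Finset S) (hJ : ∀ x ∈ J, ∀ y ∈ J, SimonDvd x y)
    (hgJ : ∀ i j, i < j → j ≤ m → g i j ∈ J)
    (hm : J.card * (J.card * l + 1) < m) :
    ∃ e : S, e * e = e ∧ ∃ F : Finset ℕ, F.card = l + 1 ∧ (∀ i ∈ F, i ≤ m) ∧
      ∀ i ∈ F, ∀ j ∈ F, i < j → g i j = e := by
  obtain ⟨s, hs, hF⟩ := Finset.exists_lt_card_fiber_of_mul_lt_card_of_maps_to
    (s := Finset.Icc 1 m) (t := J) (f := fun i => g 0 i) (n := J.card * l + 1)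
    (fun i hi => by
      rw [Finset.mem_Icc] at hi
      exact hgJ 0 i (by omega) hi.2) (by simpa using hm)
  set F := {i ∈ Finset.Icc 1 m | g 0 i = s} with hFdef
  have hFm : ∀ i ∈ F, i ≤ m ∧ g 0 i = s := by
    intro i hi
    simp only [hFdef, Finset.mem_filter, Finset.mem_Icc] at hi
    exact ⟨hi.1.2, hi.2⟩
  have hne : F.Nonempty := Finset.card_pos.mp (by omega)
  set M := F.max' hne
  have hMF : M ∈ F := F.max'_mem hne
  have hlt : ∀ i ∈ F.erase M, i < M := fun i hi =>
    lt_of_le_of_ne (F.le_max' i (Finset.mem_of_mem_erase hi)) (Finset.ne_of_mem_erase hi)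
  have hsg : ∀ i ∈ F, ∀ j ∈ F, i < j → s * g i j = s := by
    intro i hi j hj hij
    have := hg 0 i j (by omega) hij.le
    rwa [(hFm i hi).2, (hFm j hj).2] at this
  have hzero : ∀ i ∈ F, ∀ j ∈ F, i < j → ∀ i' ∈ F, ∀ j' ∈ F, i' < j' →
      g i j * g i' j' = g i j := by
    intro i hi j hj hij i' hi' j' hj' hij'
    obtain ⟨z, hz⟩ := simon_stable (hsg i hi j hj hij)
      (hJ s hs _ (hgJ i j hij (hFm j hj).1))
    rw [hz, mul_assoc, hsg i' hi' j' hj' hij']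
  obtain ⟨e, he, hG⟩ := Finset.exists_lt_card_fiber_of_mul_lt_card_of_maps_to
    (s := F.erase M) (t := J) (f := fun i => g i M) (n := l)
    (fun i hi => by
      exact hgJ i M (hlt i hi) (hFm M hMF).1)
    (by rw [Finset.card_erase_of_mem hMF]; omega)
  obtain ⟨G, hGs, hGc⟩ := Finset.exists_subset_card_eq (Nat.succ_le_of_lt hG)
  have hGm : ∀ i ∈ G, i ∈ F ∧ i < M ∧ g i M = e := by
    intro i hi
    have := Finset.mem_filter.mp (hGs hi)
    exact ⟨Finset.mem_of_mem_erase this.1, hlt i this.1, this.2⟩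
  obtain ⟨i0, hi0⟩ : G.Nonempty := Finset.card_pos.mp (by omega)
  obtain ⟨a1, a2, a3⟩ := hGm i0 hi0
  refine ⟨e, ?_, G, hGc, fun i hi => (hFm i (hGm i hi).1).1, ?_⟩
  · rw [← a3]; exact hzero i0 a1 M hMF a2 i0 a1 M hMF a2
  · intro i hi j hj hij
    obtain ⟨b1, b2, b3⟩ := hGm i hi
    obtain ⟨c1, c2, c3⟩ := hGm j hj
    rw [← b3, ← hg i j M hij.le c2.le]
    exact (hzero i b1 j c1 hij j c1 M hMF c2).symm

open Classical in
theorem simon_main {S : Type} [Monoid S] [Fintype S] (l : ℕ) (hl : 3 ≤ l)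
    (f : ℕ → ℕ → S) (hf : ∀ i j k, i ≤ j → j ≤ k → f i j * f j k = f i k) (n : ℕ) :
    ∀ a b : ℕ, (Finset.univ.filter (fun x => SimonDvd x (f a b))).card ≤ n →
      a + l ^ (3 * n) ≤ b →
    ∃ e : S, e * e = e ∧ ∃ F : Finset ℕ, F.card = l + 1 ∧ (∀ i ∈ F, a ≤ i ∧ i ≤ b) ∧
      ∀ i ∈ F, ∀ j ∈ F, i < j → f i j = e := by
  induction n using Nat.strong_induction_on with
  | _ n ih =>
  intro a b hU hab
  set s := f a b with hs
  set U := Finset.univ.filter (fun x => SimonDvd x s) with hUdef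
  set J := U.filter (fun x => SimonDvd s x) with hJdef
  have hJU : J ⊆ U := Finset.filter_subset _ _
  have hJc : J.card ≤ n := (Finset.card_le_card hJU).trans hU
  have hself : SimonDvd s s := ⟨1, 1, by simp⟩
  have hsJ : s ∈ J := by simp [hJdef, hUdef, hself]
  have hJ1 : 1 ≤ J.card := Finset.card_pos.mpr ⟨s, hsJ⟩
  have hB : 0 < l ^ (3 * (n - J.card)) := by positivity
  set B := l ^ (3 * (n - J.card)) with hBdef
  set m := l ^ (3 * J.card) with hmdef
  have hmB : l ^ (3 * n) = m * B := by
    rw [hmdef, hBdef, ← pow_add]; congr 1; omega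
  rw [hmB] at hab
  by_cases hall : ∀ i j, i < j → j ≤ m → SimonDvd s (f (a + i * B) (a + j * B))
  · obtain ⟨e, he, F, hFc, hFm, hFe⟩ := simon_class l m
      (fun i j => f (a + i * B) (a + j * B))
      (fun i j k hij hjk => hf _ _ _ (by gcongr) (by gcongr)) J
      (fun x hx y hy => by
        simp only [hJdef, hUdef, Finset.mem_filter, Finset.mem_univ, true_and] at hx hy
        exact hx.1.trans hy.2)
      (fun i j hij hjm => by
        simp only [hJdef, hUdef, Finset.mem_filter, Finset.mem_univ, true_and]
        refine ⟨⟨f a (a + i * B), f (a + j * B) b, ?_⟩, hall i j hij hjm⟩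
        have h1 : a + j * B ≤ a + m * B := by gcongr
        have h2 : a + i * B ≤ a + j * B := by gcongr
        rw [hf _ _ _ (by omega) h2, hf _ _ _ (by omega) (by omega)])
      (simon_arith l _ hl hJ1)
    refine ⟨e, he, F.image (fun i => a + i * B), ?_, ?_, ?_⟩
    · rw [Finset.card_image_of_injective _ ?_, hFc]
      intro i j hij
      exact Nat.eq_of_mul_eq_mul_right hB (Nat.add_left_cancel hij)
    · intro i hi
      obtain ⟨i, hiF, rfl⟩ := Finset.mem_image.mp hi
      have : a + i * B ≤ a + m * B := by gcongr; exact hFm i hiF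
      omega
    · intro i hi j hj hij
      obtain ⟨i, hiF, rfl⟩ := Finset.mem_image.mp hi
      obtain ⟨j, hjF, rfl⟩ := Finset.mem_image.mp hj
      exact hFe i hiF j hjF (Nat.lt_of_mul_lt_mul_right (Nat.lt_of_add_lt_add_left hij))
  · push Not at hall
    obtain ⟨i, j, hij, hjm, hnd⟩ := hall
    have h1 : a + j * B ≤ a + m * B := by gcongr
    have h3 : (i + 1) * B ≤ j * B := by gcongr; omega
    have h2 : a + i * B + B ≤ a + j * B := by rw [Nat.succ_mul] at h3; omega
    have hts : SimonDvd (f (a + i * B) (a + j * B)) s :=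
      ⟨f a (a + i * B), f (a + j * B) b, by
        rw [hf _ _ _ (by omega) (by omega), hf _ _ _ (by omega) (by omega)]⟩
    obtain ⟨e, he, F, hFc, hFm, hFe⟩ := ih (n - J.card) (by omega) (a + i * B) (a + j * B)
      (by
        have hsub : Finset.univ.filter (fun x => SimonDvd x (f (a + i * B) (a + j * B)))
            ⊆ U \ J := by
          intro x hx
          simp only [hJdef, hUdef, Finset.mem_filter, Finset.mem_univ, true_and,
            Finset.mem_sdiff] at hx ⊢
          exact ⟨hx.trans hts, fun h => hnd (h.2.trans hx)⟩
        have := Finset.card_le_card hsub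
        rw [Finset.card_sdiff_of_subset hJU] at this
        omega) h2
    exact ⟨e, he, F, hFc, fun i hi => by have := hFm i hi; omega, hFe⟩

theorem simon_split {A : Type} (w : List A) (i j k : ℕ) (hij : i ≤ j) (hjk : j ≤ k) :
    (w.drop i).take (j - i) ++ (w.drop j).take (k - j) = (w.drop i).take (k - i) := by
  have h1 : k - i = (j - i) + (k - j) := by omega
  rw [h1, List.take_add, List.drop_drop]
  congr 4; omega

/-- Simon factorization consequence.
`α : A* → S` is encoded as a function on `List A` that is a monoid morphism
(sends the empty word to `1` and concatenation to product). -/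
theorem simon_idempotent_factor
    {S A : Type} [Monoid S] [Fintype S] [Fintype A]
    (α : List A → S) (hα_one : α [] = 1)
    (hα_mul : ∀ u v : List A, α (u ++ v) = α u * α v)
    (ℓ : ℕ) (hℓ : 3 ≤ ℓ)
    (w : List A) (hw : ℓ ^ (3 * Fintype.card S) ≤ w.length) :
    ∃ (e : S) (u v : List A) (ws : List (List A)),
      e * e = e ∧
      ws.length = ℓ ∧
      (∀ wi ∈ ws, wi ≠ [] ∧ α wi = e) ∧
      w = u ++ ws.flatten ++ v := by
  classical
  obtain ⟨e, he, F, hFc, hFm, hFe⟩ := simon_main ℓ hℓ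
    (fun i j => α ((w.drop i).take (j - i)))
    (fun i j k hij hjk => by rw [← hα_mul, simon_split w i j k hij hjk])
    (Fintype.card S) 0 w.length (Finset.card_le_univ _) (by omega)
  let q : ℕ → ℕ := fun i => F.orderEmbOfFin hFc (Fin.ofNat (ℓ + 1) i)
  have hqF : ∀ i, q i ∈ F := fun i => F.orderEmbOfFin_mem hFc _
  have hq : ∀ i j, i < j → j ≤ ℓ → q i < q j := by
    intro i j hij hj
    refine (F.orderEmbOfFin hFc).strictMono ?_
    rw [Fin.lt_def]
    simp only [Fin.ofNat]
    rw [Nat.mod_eq_of_lt (by omega), Nat.mod_eq_of_lt (by omega)]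
    exact hij
  have hflat : ∀ n, n ≤ ℓ →
      ((List.range n).map (fun i => (w.drop (q i)).take (q (i + 1) - q i))).flatten
        = (w.drop (q 0)).take (q n - q 0) := by
    intro n
    induction n with
    | zero => simp
    | succ n ih =>
      intro hn
      have h0 : q 0 ≤ q n := by
        rcases Nat.eq_zero_or_pos n with h | h
        · rw [h]
        · exact (hq 0 n h (by omega)).le
      rw [List.range_succ, List.map_append, List.flatten_append, ih (by omega)]
      simp only [List.map_cons, List.map_nil, List.flatten_cons, List.flatten_nil,
        List.append_nil]
      exact simon_split w _ _ _ h0 (hq n (n + 1) (by omega) hn).le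
  refine ⟨e, w.take (q 0), w.drop (q ℓ),
    (List.range ℓ).map (fun i => (w.drop (q i)).take (q (i + 1) - q i)), he, by simp, ?_, ?_⟩
  · intro wi hwi
    obtain ⟨i, hi, rfl⟩ := List.mem_map.mp hwi
    rw [List.mem_range] at hi
    have h1 := hq i (i + 1) (by omega) (by omega)
    have h2 := (hFm _ (hqF (i + 1))).2
    refine ⟨?_, hFe _ (hqF i) _ (hqF (i + 1)) h1⟩
    intro h
    have := congrArg List.length h
    simp only [List.length_take, List.length_drop, List.length_nil] at this
    omega
  · have h0 := hq 0 ℓ (by omega) le_rfl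
    rw [hflat ℓ le_rfl]
    have h3 : w.take (q 0) ++ (w.drop (q 0)).take (q ℓ - q 0) = w.take (q ℓ) := by
      have := simon_split w 0 (q 0) (q ℓ) (by omega) h0.le
      simpa using this
    rw [h3, List.take_append_drop]
end

section
/- There exists a constant C such that for every simple digraph H and every tournament T that does not contain H as an immersion, ctw(T) ≤ C·(|V(H)| + |A(H)|)². -/
namespace TournamentPaper

open Classical

/-- A finite simple directed graph. -/
structure Digr (V : Type) where
  Adj : V → V → Prop
  loopless : ∀ v, ¬ Adj v v

namespace Digr

variable {V : Type}

/-- A tournament: exactly one of the two arcs between any two distinct vertices. -/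
def IsTournament (T : Digr V) : Prop :=
  ∀ u v : V, u ≠ v → (T.Adj u v ↔ ¬ T.Adj v u)

/-- The arc set, as a set of ordered pairs. -/
def arcs (T : Digr V) : Set (V × V) := {e | T.Adj e.1 e.2}

/-- The subdigraph induced by a set of vertices. -/
def induce (T : Digr V) (X : Set V) : Digr V where
  Adj u v := u ∈ X ∧ v ∈ X ∧ T.Adj u v
  loopless v h := T.loopless v h.2.2

/-- Deletion of a set of arcs. -/
def deleteArcs (T : Digr V) (F : Set (V × V)) : Digr V where
  Adj u v := T.Adj u v ∧ (u, v) ∉ F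
  loopless v h := T.loopless v h.1

/-- Outdegree of a vertex. -/
noncomputable def outdeg (T : Digr V) (u : V) : ℕ := {v | T.Adj u v}.ncard

end Digr

variable {V : Type}

/-- An ordering of the vertex set: a bijection onto `{1, …, |V|}`. -/
def IsOrdering [Fintype V] (σ : V → ℕ) : Prop :=
  Set.BijOn σ Set.univ (Set.Icc 1 (Fintype.card V))

/-- The `γ`-cut of an ordering: arcs `(u,v)` with `σ u > γ ≥ σ v`. -/
def cutAt (T : Digr V) (σ : V → ℕ) (γ : ℕ) : Set (V × V) :=
  {e | T.Adj e.1 e.2 ∧ γ < σ e.1 ∧ σ e.2 ≤ γ}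

/-- The width of an ordering: the maximal size of a cut. -/
noncomputable def width [Fintype V] (T : Digr V) (σ : V → ℕ) : ℕ :=
  (Finset.range (Fintype.card V + 1)).sup fun γ => (cutAt T σ γ).ncard

/-- The cutwidth: the minimum width over all orderings. -/
noncomputable def ctw [Fintype V] (T : Digr V) : ℕ :=
  sInf {w | ∃ σ : V → ℕ, IsOrdering σ ∧ width T σ = w}

/-- The σ-interval `σ(a, b]`. -/
def interval (σ : V → ℕ) (a b : ℕ) : Set V := {v | a < σ v ∧ σ v ≤ b}

/-- Arcs of `T` from `X` to `Y`. -/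
def arcsBetween (T : Digr V) (X Y : Set V) : Set (V × V) :=
  {e | T.Adj e.1 e.2 ∧ e.1 ∈ X ∧ e.2 ∈ Y}

/-- `∂⁺(I)` for `I = σ(a,b]`: arcs from `I` to `σ(0,a]`. -/
def dPlus [Fintype V] (T : Digr V) (σ : V → ℕ) (a b : ℕ) : Set (V × V) :=
  arcsBetween T (interval σ a b) (interval σ 0 a)

/-- `∂⁻(I)`: arcs from `σ(b,|V|]` to `I`. -/
def dMinus [Fintype V] (T : Digr V) (σ : V → ℕ) (a b : ℕ) : Set (V × V) :=
  arcsBetween T (interval σ b (Fintype.card V)) (interval σ a b)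

/-- `Γ⁺(I)`: arcs from `I` to `σ(b,|V|]`. -/
def gPlus [Fintype V] (T : Digr V) (σ : V → ℕ) (a b : ℕ) : Set (V × V) :=
  arcsBetween T (interval σ a b) (interval σ b (Fintype.card V))

/-- `Γ⁻(I)`: arcs from `σ(0,a]` to `I`. -/
def gMinus [Fintype V] (T : Digr V) (σ : V → ℕ) (a b : ℕ) : Set (V × V) :=
  arcsBetween T (interval σ 0 a) (interval σ a b)

/-- The interval `σ(a,b]` is `c`-flat: `|∂⁺| ≤ c`, `|∂⁻| ≤ c`, and the restriction
of `σ` to the induced subtournament has width at most `c`. -/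
def Flat [Fintype V] (T : Digr V) (σ : V → ℕ) (a b c : ℕ) : Prop :=
  (dPlus T σ a b).ncard ≤ c ∧ (dMinus T σ a b).ncard ≤ c ∧
  ∀ γ : ℕ, (cutAt (T.induce (interval σ a b)) σ γ).ncard ≤ c

/-- The list of arcs of a list of vertices (viewed as a walk). -/
def listArcs (l : List V) : List (V × V) := l.zip l.tail

/-- An immersion model of `H` in `G`: an injective vertex map together with, for each
arc of `H`, a directed simple path in `G` between the images of its endpoints, the
paths being pairwise arc-disjoint. -/
structure ImmersionModel {VH V : Type} (H : Digr VH) (G : Digr V) where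
  vmap : VH → V
  inj : Function.Injective vmap
  path : ∀ e : VH × VH, H.Adj e.1 e.2 → List V
  chain : ∀ e he, (path e he).Chain' G.Adj
  nodup : ∀ e he, (path e he).Nodup
  head : ∀ e he, (path e he).head? = some (vmap e.1)
  last : ∀ e he, (path e he).getLast? = some (vmap e.2)
  arc_disj : ∀ e he e' he', e ≠ e' → ∀ x ∈ listArcs (path e he), x ∉ listArcs (path e' he')

/-- The set of arcs of `G` used by an immersion model. -/
def ImmersionModel.arcsUsed {VH V : Type} {H : Digr VH} {G : Digr V}
    (M : ImmersionModel H G) : Set (V × V) :=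
  {x | ∃ e he, x ∈ listArcs (M.path e he)}

/-- `G` contains `H` as an immersion. -/
def HasImm {VH V : Type} (H : Digr VH) (G : Digr V) : Prop :=
  Nonempty (ImmersionModel H G)

/-- A family of pairwise arc-disjoint immersion models. -/
def ArcDisjointModels {VH V : Type} {H : Digr VH} {G : Digr V} {k : ℕ}
    (M : Fin k → ImmersionModel H G) : Prop :=
  ∀ i j, i ≠ j → Disjoint (M i).arcsUsed (M j).arcsUsed


/-! ### Auxiliary notions and lemmas -/

/-- Walks of length at most `n` for a relation. -/
def Wk (R : V → V → Prop) : ℕ → V → V → Prop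
  | 0, u, v => u = v
  | n + 1, u, v => u = v ∨ ∃ w, R u w ∧ Wk R n w v

/-- The arcs of `T` avoiding `F`. -/
def Av (T : Digr V) (F : Finset (V × V)) (u v : V) : Prop := T.Adj u v ∧ (u, v) ∉ F

/-- Robust linkedness by walks of length at most four. -/
def Link (T : Digr V) (s : ℕ) (u v : V) : Prop :=
  ∀ F : Finset (V × V), F.card ≤ s → Wk (Av T F) 4 u v

/-- Robust linkedness by walks of length exactly two. -/
def Link2 (T : Digr V) (s : ℕ) (u v : V) : Prop :=
  ∀ F : Finset (V × V), F.card ≤ s → ∃ x, Av T F u x ∧ Av T F x v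

lemma listArcs_cons_cons (u w : V) (l : List V) :
    listArcs (u :: w :: l) = (u, w) :: listArcs (w :: l) := by
  simp [listArcs]

lemma listArcs_mem_of_chain {R : V → V → Prop} :
    ∀ (l : List V), l.IsChain R → ∀ x ∈ listArcs l, R x.1 x.2
  | [], _, x, hx => by simp [listArcs] at hx
  | [a], _, x, hx => by simp [listArcs] at hx
  | a :: b :: l, h, x, hx => by
    rw [listArcs_cons_cons] at hx
    rw [List.isChain_cons_cons] at h
    rcases List.mem_cons.1 hx with rfl | hx
    · exact h.1
    · exact listArcs_mem_of_chain (b :: l) h.2 x hx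

lemma Wk.exists_path {R : V → V → Prop} : ∀ (n : ℕ) (u v : V), Wk R n u v →
    ∃ l : List V, l.IsChain R ∧ l.Nodup ∧ l.head? = some u ∧ l.getLast? = some v ∧
      l.length ≤ n + 1
  | 0, u, v, h => by
    have h : u = v := h
    subst h
    exact ⟨[u], by simp⟩
  | n + 1, u, v, h => by
    rcases h with rfl | ⟨w, hw, h⟩
    · exact ⟨[u], by simp⟩
    · obtain ⟨l, hc, hn, hh, hl, hlen⟩ := Wk.exists_path n w v h
      by_cases hu : u ∈ l
      · obtain ⟨s, t, rfl⟩ := List.append_of_mem hu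
        refine ⟨u :: t, (List.isChain_append.1 hc).2.1, (List.nodup_append.1 hn).2.1, rfl, ?_, ?_⟩
        · rw [← hl, List.getLast?_append_cons]
        · simp at hlen ⊢; omega
      · cases l with
        | nil => simp at hh
        | cons a l =>
          simp at hh
          subst hh
          refine ⟨u :: a :: l, ?_, ?_, rfl, ?_, ?_⟩
          · exact List.isChain_cons_cons.2 ⟨hw, hc⟩
          · exact List.nodup_cons.2 ⟨hu, hn⟩
          · rw [← hl]; simp
          · simp at hlen ⊢; omega

lemma exists_free {F : Finset (V × V)} {s : ℕ} (hF : F.card ≤ s) (S : Finset V)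
    (f g : V → V × V) (hf : Set.InjOn f S) (hg : Set.InjOn g S) (hS : 2 * s < S.card) :
    ∃ x ∈ S, f x ∉ F ∧ g x ∉ F := by
  by_contra! hcon
  have h1 : (S.filter fun x => f x ∈ F).card ≤ F.card :=
    Finset.card_le_card_of_injOn f (fun x hx => by simpa using (Finset.mem_filter.1 hx).2)
      (hf.mono (by simp [Set.subset_def]; tauto))
  have h2 : (S.filter fun x => g x ∈ F).card ≤ F.card :=
    Finset.card_le_card_of_injOn g (fun x hx => by simpa using (Finset.mem_filter.1 hx).2)
      (hg.mono (by simp [Set.subset_def]; tauto))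
  have h3 : S ⊆ (S.filter fun x => f x ∈ F) ∪ (S.filter fun x => g x ∈ F) := by
    intro x hx
    by_cases h : f x ∈ F
    · simp [hx, h]
    · simp [hx, hcon x hx h]
  have h4 := (Finset.card_le_card h3).trans (Finset.card_union_le _ _)
  omega

lemma tour_card {r : V → V → Prop} (S : Finset V) (c : ℕ)
    (hr : ∀ x ∈ S, ∀ y ∈ S, x ≠ y → r x y ∨ r y x)
    (h : ∀ x ∈ S, (S.filter (r x)).card ≤ c) : S.card ≤ 2 * c + 1 := by
  have key : ((S ×ˢ S).filter fun e => r e.1 e.2).card ≤ S.card * c := by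
    rw [Finset.card_filter, Finset.sum_product]
    rw [← smul_eq_mul]
    apply Finset.sum_le_card_nsmul
    intro x hx
    rw [← Finset.card_filter]
    exact h x hx
  have key2 : ((S ×ˢ S).filter fun e => r e.2 e.1).card ≤ S.card * c := by
    rw [Finset.card_filter, Finset.sum_product_right]
    rw [← smul_eq_mul]
    apply Finset.sum_le_card_nsmul
    intro x hx
    rw [← Finset.card_filter]
    exact h x hx
  have hsub : S.offDiag ⊆ ((S ×ˢ S).filter fun e => r e.1 e.2) ∪
      ((S ×ˢ S).filter fun e => r e.2 e.1) := by
    rintro ⟨x, y⟩ he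
    rw [Finset.mem_offDiag] at he
    have := hr x he.1 y he.2.1 he.2.2
    simp only [Finset.mem_union, Finset.mem_filter, Finset.mem_product]
    tauto
  have h4 := (Finset.card_le_card hsub).trans (Finset.card_union_le _ _)
  rw [Finset.offDiag_card] at h4
  by_contra! hcon
  have : S.card * (2 * c + 2) ≤ S.card * S.card := Nat.mul_le_mul_left _ hcon
  have h5 : S.card * (2 * c + 2) = 2 * (S.card * c) + 2 * S.card := by ring
  omega

section Core

variable [Fintype V]

/-- Outdegree as a finset cardinality. -/
noncomputable def od (T : Digr V) (v : V) : ℕ := (Finset.univ.filter (T.Adj v)).card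

/-- Indegree as a finset cardinality. -/
noncomputable def idg (T : Digr V) (v : V) : ℕ :=
  (Finset.univ.filter fun u => T.Adj u v).card

lemma total {T : Digr V} (hT : T.IsTournament) {x y : V} (h : x ≠ y) :
    T.Adj x y ∨ T.Adj y x := by
  have := hT x y h
  tauto

lemma od_add_idg {T : Digr V} (hT : T.IsTournament) (v : V) :
    od T v + idg T v + 1 = Fintype.card V := by
  have h1 : Disjoint (Finset.univ.filter (T.Adj v)) (Finset.univ.filter fun u => T.Adj u v) := by
    rw [Finset.disjoint_left]
    intro x hx hx'
    simp at hx hx'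
    have hne : v ≠ x := by rintro rfl; exact T.loopless _ hx
    exact (hT v x hne).1 hx hx'
  have h2 : (Finset.univ.filter (T.Adj v)) ∪ (Finset.univ.filter fun u => T.Adj u v)
      = Finset.univ.erase v := by
    ext x
    simp
    constructor
    · rintro (h | h) rfl <;> exact T.loopless _ h
    · intro h; exact total hT (Ne.symm h)
  have h3 := Finset.card_union_of_disjoint h1
  rw [h2, Finset.card_erase_of_mem (Finset.mem_univ v), Finset.card_univ] at h3
  have : 0 < Fintype.card V := Fintype.card_pos_iff.2 ⟨v⟩
  unfold od idg
  omega

lemma gap_link {T : Digr V} (hT : T.IsTournament) {s : ℕ} {a b : V}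
    (h : od T b + (2 * s + 2) ≤ od T a) : Link2 T s a b := by
  intro F hF
  let S := Finset.univ.filter fun x => T.Adj a x ∧ T.Adj x b
  have hsub : Finset.univ.filter (T.Adj a) ⊆ S ∪ insert b (Finset.univ.filter (T.Adj b)) := by
    intro x hx
    simp at hx
    by_cases hxb : x = b
    · simp [hxb]
    · have := total hT hxb
      simp [S]; tauto
  have h1 := (Finset.card_le_card hsub).trans (Finset.card_union_le _ _)
  have h2 := Finset.card_insert_le b (Finset.univ.filter (T.Adj b))
  have hS : 2 * s < S.card := by unfold od at h; omega
  obtain ⟨x, hx, h3, h4⟩ := exists_free hF S (fun x => (a, x)) (fun x => (x, b))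
    (by intro x _ y _ h; simpa using h) (by intro x _ y _ h; simpa using h) hS
  simp [S] at hx
  exact ⟨x, ⟨hx.1, h3⟩, ⟨hx.2, h4⟩⟩

/-- Many vertices of almost equal outdegree are pairwise robustly linked. -/
lemma tangle_link {T : Digr V} (hT : T.IsTournament) {s k α : ℕ} (W : Finset V)
    (hW : ∀ v ∈ W, α ≤ od T v + k ∧ od T v ≤ α + k)
    (hcard : 10 * s + 10 * k + 3 < W.card) {a b : V} (ha : a ∈ W) (hb : b ∈ W) :
    Link T s a b := by
  intro F hF
  by_contra hno
  let P := Finset.univ.filter fun x => Av T F a x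
  let Q := Finset.univ.filter fun y => Av T F y b
  have hP : od T a ≤ P.card + s := by
    have hsub : Finset.univ.filter (T.Adj a) ⊆ P ∪ F.image Prod.snd := by
      intro x hx
      simp at hx
      by_cases hxF : (a, x) ∈ F
      · exact Finset.mem_union_right _ (Finset.mem_image.2 ⟨_, hxF, rfl⟩)
      · exact Finset.mem_union_left _ (Finset.mem_filter.2 ⟨Finset.mem_univ _, hx, hxF⟩)
    have h1 := (Finset.card_le_card hsub).trans (Finset.card_union_le _ _)
    have h2 := Finset.card_image_le (s := F) (f := Prod.snd)
    unfold od; omega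
  have hQ : idg T b ≤ Q.card + s := by
    have hsub : (Finset.univ.filter fun u => T.Adj u b) ⊆ Q ∪ F.image Prod.fst := by
      intro x hx
      simp at hx
      by_cases hxF : (x, b) ∈ F
      · exact Finset.mem_union_right _ (Finset.mem_image.2 ⟨_, hxF, rfl⟩)
      · exact Finset.mem_union_left _ (Finset.mem_filter.2 ⟨Finset.mem_univ _, hx, hxF⟩)
    have h1 := (Finset.card_le_card hsub).trans (Finset.card_union_le _ _)
    have h2 := Finset.card_image_le (s := F) (f := Prod.fst)
    unfold idg; omega
  have hPQ : Disjoint P Q := by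
    rw [Finset.disjoint_left]
    intro x hx hx'
    simp [P] at hx
    simp [Q] at hx'
    exact hno (Or.inr ⟨x, hx, Or.inr ⟨b, hx', Or.inl rfl⟩⟩)
  have hback : ∀ x ∈ P, ∀ y ∈ Q, (x, y) ∈ F ∨ T.Adj y x := by
    intro x hx y hy
    have hne : x ≠ y := by
      rintro rfl; exact Finset.disjoint_left.1 hPQ hx hy
    by_contra! hc
    have hxy : T.Adj x y := by
      rcases total hT hne with h | h
      · exact h
      · exact absurd h hc.2
    simp [P] at hx
    simp [Q] at hy
    exact hno (Or.inr ⟨x, hx, Or.inr ⟨y, ⟨hxy, hc.1⟩, Or.inr ⟨b, hy, Or.inl rfl⟩⟩⟩)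
  have ha' := hW a ha
  have hb' := hW b hb
  have hbd := od_add_idg hT b
  -- the part in `Q`
  have hWQ : (W ∩ Q).card ≤ 2 * (2 * s + 2 * k) + 1 := by
    apply tour_card (r := T.Adj)
    · intro x _ y _ h; exact total hT h
    · intro y hy
      have hyW := hW y (Finset.mem_inter.1 hy).1
      have hyQ := (Finset.mem_inter.1 hy).2
      have hsub : P ⊆ (P.filter (T.Adj y)) ∪ F.image Prod.fst := by
        intro x hx
        rcases hback x hx y hyQ with h | h
        · exact Finset.mem_union_right _ (Finset.mem_image.2 ⟨_, h, rfl⟩)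
        · exact Finset.mem_union_left _ (by simp [hx, h])
      have h1 := (Finset.card_le_card hsub).trans (Finset.card_union_le _ _)
      have h2 := Finset.card_image_le (s := F) (f := Prod.fst)
      have hd : Disjoint (P.filter (T.Adj y)) ((W ∩ Q).filter (T.Adj y)) := by
        apply Finset.disjoint_of_subset_left (Finset.filter_subset _ _)
        apply Finset.disjoint_of_subset_right (Finset.filter_subset _ _)
        exact Finset.disjoint_of_subset_right Finset.inter_subset_right hPQ
      have h3 := Finset.card_union_of_disjoint hd
      have h4 : (P.filter (T.Adj y)) ∪ ((W ∩ Q).filter (T.Adj y)) ⊆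
          Finset.univ.filter (T.Adj y) := by
        intro x hx
        simp at hx ⊢
        tauto
      have h5 := Finset.card_le_card h4
      have h6 : od T y = (Finset.univ.filter (T.Adj y)).card := rfl
      omega
  have hWP : (W ∩ P).card ≤ 2 * (2 * s + 2 * k) + 1 := by
    apply tour_card (r := fun x y => T.Adj y x)
    · intro x _ y _ h; exact (total hT h).symm
    · intro x hx
      have hxW := hW x (Finset.mem_inter.1 hx).1
      have hxP := (Finset.mem_inter.1 hx).2
      have hsub : Q ⊆ (Q.filter fun y => T.Adj y x) ∪ F.image Prod.snd := by
        intro y hy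
        rcases hback x hxP y hy with h | h
        · exact Finset.mem_union_right _ (Finset.mem_image.2 ⟨_, h, rfl⟩)
        · exact Finset.mem_union_left _ (by simp [hy, h])
      have h1 := (Finset.card_le_card hsub).trans (Finset.card_union_le _ _)
      have h2 := Finset.card_image_le (s := F) (f := Prod.snd)
      have hd : Disjoint (Q.filter fun y => T.Adj y x) ((W ∩ P).filter fun y => T.Adj y x) := by
        apply Finset.disjoint_of_subset_left (Finset.filter_subset _ _)
        apply Finset.disjoint_of_subset_right (Finset.filter_subset _ _)
        exact Finset.disjoint_of_subset_right Finset.inter_subset_right hPQ.symm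
      have h3 := Finset.card_union_of_disjoint hd
      have h4 : (Q.filter fun y => T.Adj y x) ∪ ((W ∩ P).filter fun y => T.Adj y x) ⊆
          Finset.univ.filter fun y => T.Adj y x := by
        intro x hx
        simp at hx ⊢
        tauto
      have h5 := Finset.card_le_card h4
      have h6 : idg T x = (Finset.univ.filter fun y => T.Adj y x).card := rfl
      have h7 := od_add_idg hT x
      omega
  have hR : (P ∪ Q)ᶜ.card ≤ 1 + 2 * s + 2 * k := by
    rw [Finset.card_compl, Finset.card_union_of_disjoint hPQ]
    omega
  have hsub : W ⊆ (W ∩ P) ∪ ((W ∩ Q) ∪ (P ∪ Q)ᶜ) := by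
    intro x hx
    simp [hx]
    tauto
  have h1 := Finset.card_le_card hsub
  have h2 := Finset.card_union_le (W ∩ P) ((W ∩ Q) ∪ (P ∪ Q)ᶜ)
  have h3 := Finset.card_union_le (W ∩ Q) ((P ∪ Q)ᶜ)
  omega

lemma family_jungle {T : Digr V} (hT : T.IsTournament) {s : ℕ} (Q : Finset V) (p : V → V)
    (hp : ∀ q ∈ Q, T.Adj (p q) q) (hl : ∀ q ∈ Q, ∀ q' ∈ Q, Link2 T s q (p q'))
    (hQ : 5 * s + 1 ≤ Q.card) :
    ∃ X : Finset V, s ≤ X.card ∧ ∀ u ∈ X, ∀ v ∈ X, Link T s u v := by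
  let X := Q.filter fun q => 2 * s < (Q.filter fun q' => T.Adj q' q).card
  let Y := Q.filter fun q => ¬ 2 * s < (Q.filter fun q' => T.Adj q' q).card
  have hXY : X.card + Y.card = Q.card := Finset.card_filter_add_card_filter_not _
  have hY : Y.card ≤ 2 * (2 * s) + 1 := by
    apply tour_card (r := fun x y => T.Adj y x)
    · intro x _ y _ h; exact (total hT h).symm
    · intro x hx
      have h1 := (Finset.mem_filter.1 hx).2
      have h2 : (Y.filter fun y => T.Adj y x) ⊆ Q.filter fun q' => T.Adj q' x :=
        Finset.filter_subset_filter _ (Finset.filter_subset _ _)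
      have := Finset.card_le_card h2
      omega
  refine ⟨X, by omega, ?_⟩
  intro u hu v hv F hF
  have hu' := (Finset.mem_filter.1 hu).1
  have hv' := (Finset.mem_filter.1 hv).2
  obtain ⟨q, hq, h3, h4⟩ := exists_free hF (Q.filter fun q' => T.Adj q' v)
    (fun q => (p q, q)) (fun q => (q, v))
    (by intro x _ y _ h; exact (Prod.ext_iff.1 h).2) (by intro x _ y _ h; simpa using h) hv'
  obtain ⟨hqQ, hqv⟩ := Finset.mem_filter.1 hq
  obtain ⟨x, hx1, hx2⟩ := hl u hu' q hqQ F hF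
  exact Or.inr ⟨x, hx1, Or.inr ⟨p q, hx2, Or.inr ⟨q, ⟨hp q hqQ, h3⟩,
    Or.inr ⟨v, ⟨hqv, h4⟩, rfl⟩⟩⟩⟩

lemma family_jungle' {T : Digr V} (hT : T.IsTournament) {s : ℕ} (P : Finset V) (q : V → V)
    (hq : ∀ p ∈ P, T.Adj p (q p)) (hl : ∀ p ∈ P, ∀ p' ∈ P, Link2 T s (q p) p')
    (hP : 5 * s + 1 ≤ P.card) :
    ∃ X : Finset V, s ≤ X.card ∧ ∀ u ∈ X, ∀ v ∈ X, Link T s u v := by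
  let X := P.filter fun p => 2 * s < (P.filter (T.Adj p)).card
  let Y := P.filter fun p => ¬ 2 * s < (P.filter (T.Adj p)).card
  have hXY : X.card + Y.card = P.card := Finset.card_filter_add_card_filter_not _
  have hY : Y.card ≤ 2 * (2 * s) + 1 := by
    apply tour_card (r := T.Adj)
    · intro x _ y _ h; exact total hT h
    · intro x hx
      have h1 := (Finset.mem_filter.1 hx).2
      have h2 : (Y.filter (T.Adj x)) ⊆ P.filter (T.Adj x) :=
        Finset.filter_subset_filter _ (Finset.filter_subset _ _)
      have := Finset.card_le_card h2
      omega
  refine ⟨X, by omega, ?_⟩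
  intro u hu v hv F hF
  have hv' := (Finset.mem_filter.1 hv).1
  have hu' := (Finset.mem_filter.1 hu).2
  obtain ⟨p, hp, h3, h4⟩ := exists_free hF (P.filter (T.Adj u))
    (fun p => (u, p)) (fun p => (p, q p))
    (by intro x _ y _ h; simpa using h) (by intro x _ y _ h; exact (Prod.ext_iff.1 h).1) hu'
  obtain ⟨hpP, hup⟩ := Finset.mem_filter.1 hp
  obtain ⟨x, hx1, hx2⟩ := hl p hpP v hv' F hF
  exact Or.inr ⟨p, ⟨hup, h3⟩, Or.inr ⟨q p, ⟨hq p hpP, h4⟩, Or.inr ⟨x, hx1,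
    Or.inr ⟨v, hx2, rfl⟩⟩⟩⟩

/-- Many backward arcs across a degree cut give a jungle. -/
lemma core {T : Digr V} (hT : T.IsTournament) {s α : ℕ} (hs : 1 ≤ s) (A B : Finset V)
    (hA : ∀ a ∈ A, α ≤ od T a) (hB : ∀ b ∈ B, od T b ≤ α)
    (hE : 7670 * s ^ 2 < ((B ×ˢ A).filter fun e => T.Adj e.1 e.2).card) :
    ∃ X : Finset V, s ≤ X.card ∧ ∀ u ∈ X, ∀ v ∈ X, Link T s u v := by
  let k := 2 * s + 2
  let W := Finset.univ.filter fun v => α ≤ od T v + k ∧ od T v ≤ α + k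
  by_cases hWc : 53 * s < W.card
  · refine ⟨W, by omega, fun u hu v hv => ?_⟩
    exact tangle_link hT (k := k) (α := α) W (fun v hv => (Finset.mem_filter.1 hv).2)
      (by omega) hu hv
  let A' := A.filter fun a => α + k < od T a
  let B' := B.filter fun b => od T b + k < α
  have hAW : A \ A' ⊆ W := by
    intro x hx
    simp only [A', Finset.mem_sdiff, Finset.mem_filter, not_and] at hx
    have h1 := hA x hx.1
    have h2 := hx.2 hx.1
    simp only [W, Finset.mem_filter, Finset.mem_univ, true_and]
    omega
  have hBW : B \ B' ⊆ W := by
    intro x hx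
    simp only [B', Finset.mem_sdiff, Finset.mem_filter, not_and] at hx
    have h1 := hB x hx.1
    have h2 := hx.2 hx.1
    simp only [W, Finset.mem_filter, Finset.mem_univ, true_and]
    omega
  have hl1 : ∀ a ∈ A', ∀ b ∈ B, Link2 T s a b := by
    intro a ha b hb
    apply gap_link hT
    have h1 := (Finset.mem_filter.1 ha).2
    have h2 := hB b hb
    omega
  have hl2 : ∀ a ∈ A, ∀ b ∈ B', Link2 T s a b := by
    intro a ha b hb
    apply gap_link hT
    have h1 := (Finset.mem_filter.1 hb).2
    have h2 := hA a ha
    omega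
  -- star cases
  by_cases hst1 : ∃ u ∈ B, 59 * s < (A.filter (T.Adj u)).card
  · obtain ⟨u, hu, hc⟩ := hst1
    apply family_jungle hT (A'.filter (T.Adj u)) (fun _ => u)
    · intro q hq; exact (Finset.mem_filter.1 hq).2
    · intro q hq q' _; exact hl1 q (Finset.mem_filter.1 hq).1 u hu
    · have hsub : A.filter (T.Adj u) ⊆ A'.filter (T.Adj u) ∪ W := by
        intro x hx
        obtain ⟨h1, h2⟩ := Finset.mem_filter.1 hx
        by_cases hx' : x ∈ A'
        · exact Finset.mem_union_left _ (Finset.mem_filter.2 ⟨hx', h2⟩)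
        · exact Finset.mem_union_right _ (hAW (Finset.mem_sdiff.2 ⟨h1, hx'⟩))
      have h1 := (Finset.card_le_card hsub).trans (Finset.card_union_le _ _)
      omega
  by_cases hst2 : ∃ u ∈ A, 59 * s < (B.filter fun b => T.Adj b u).card
  · obtain ⟨u, hu, hc⟩ := hst2
    apply family_jungle' hT (B'.filter fun b => T.Adj b u) (fun _ => u)
    · intro q hq; exact (Finset.mem_filter.1 hq).2
    · intro q _ q' hq; exact hl2 u hu q' (Finset.mem_filter.1 hq).1
    · have hsub : (B.filter fun b => T.Adj b u) ⊆ (B'.filter fun b => T.Adj b u) ∪ W := by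
        intro x hx
        obtain ⟨h1, h2⟩ := Finset.mem_filter.1 hx
        by_cases hx' : x ∈ B'
        · exact Finset.mem_union_left _ (Finset.mem_filter.2 ⟨hx', h2⟩)
        · exact Finset.mem_union_right _ (hBW (Finset.mem_sdiff.2 ⟨h1, hx'⟩))
      have h1 := (Finset.card_le_card hsub).trans (Finset.card_union_le _ _)
      omega
  push Not at hst1 hst2
  -- maximum matching
  let E' := (B' ×ˢ A').filter fun e => T.Adj e.1 e.2
  let Ms := E'.powerset.filter fun M : Finset (V × V) => Set.InjOn Prod.fst (M : Set (V × V)) ∧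
    Set.InjOn Prod.snd (M : Set (V × V))
  have hne : Ms.Nonempty := ⟨∅, by simp [Ms]⟩
  obtain ⟨M, hM, hmax⟩ := Finset.exists_max_image Ms Finset.card hne
  obtain ⟨hME, hi1, hi2⟩ := Finset.mem_filter.1 hM
  rw [Finset.mem_powerset] at hME
  by_cases hMc : 6 * s ≤ M.card
  · have hex : ∀ q : V, ∃ p : V, q ∈ M.image Prod.snd → (p, q) ∈ M := by
      intro q
      by_cases hq : q ∈ M.image Prod.snd
      · obtain ⟨⟨x, y⟩, he, rfl⟩ := Finset.mem_image.1 hq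
        exact ⟨x, fun _ => he⟩
      · exact ⟨q, fun h => absurd h hq⟩
    choose p hp using hex
    have hmem : ∀ e ∈ M, e.1 ∈ B' ∧ e.2 ∈ A' ∧ T.Adj e.1 e.2 := by
      intro e he
      have := hME he
      simp only [E', Finset.mem_filter, Finset.mem_product] at this
      tauto
    apply family_jungle hT (M.image Prod.snd) p
    · intro q hq
      exact (hmem _ (hp q hq)).2.2
    · intro q hq q' hq'
      exact hl1 q (hmem _ (hp q hq)).2.1 _ (Finset.mem_filter.1 (hmem _ (hp q' hq')).1).1
    · rw [Finset.card_image_of_injOn hi2]; omega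
  exfalso
  let U := W ∪ (M.image Prod.fst ∪ M.image Prod.snd)
  have hU : U.card ≤ 65 * s := by
    have h1 := Finset.card_union_le W (M.image Prod.fst ∪ M.image Prod.snd)
    have h2 := Finset.card_union_le (M.image Prod.fst) (M.image Prod.snd)
    have h3 := Finset.card_image_le (s := M) (f := Prod.fst)
    have h4 := Finset.card_image_le (s := M) (f := Prod.snd)
    have : U.card = (W ∪ (M.image Prod.fst ∪ M.image Prod.snd)).card := rfl
    omega
  have hcov : ∀ b ∈ B, ∀ a ∈ A, T.Adj b a → b ∈ U ∨ a ∈ U := by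
    intro b hb a ha hba
    by_contra! hc
    simp only [U, Finset.mem_union, not_or] at hc
    obtain ⟨⟨hbW, hb1, -⟩, haW, -, ha2⟩ := hc
    have hb' : b ∈ B' := by
      by_contra h; exact hbW (hBW (Finset.mem_sdiff.2 ⟨hb, h⟩))
    have ha' : a ∈ A' := by
      by_contra h; exact haW (hAW (Finset.mem_sdiff.2 ⟨ha, h⟩))
    have hnot : (b, a) ∉ M := fun h => hb1 (Finset.mem_image.2 ⟨_, h, rfl⟩)
    have hnew : insert (b, a) M ∈ Ms := by
      refine Finset.mem_filter.2 ⟨Finset.mem_powerset.2 ?_, ?_, ?_⟩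
      · refine Finset.insert_subset ?_ hME
        simp only [E', Finset.mem_filter, Finset.mem_product]
        exact ⟨⟨hb', ha'⟩, hba⟩
      · rw [Finset.coe_insert, Set.injOn_insert (by simpa using hnot)]
        refine ⟨hi1, ?_⟩
        rintro ⟨e, he, h⟩
        exact hb1 (Finset.mem_image.2 ⟨e, by simpa using he, h⟩)
      · rw [Finset.coe_insert, Set.injOn_insert (by simpa using hnot)]
        refine ⟨hi2, ?_⟩
        rintro ⟨e, he, h⟩
        exact ha2 (Finset.mem_image.2 ⟨e, by simpa using he, h⟩)
    have := hmax _ hnew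
    rw [Finset.card_insert_of_notMem hnot] at this
    omega
  let E1 := ((U ∩ B) ×ˢ A).filter fun e => T.Adj e.1 e.2
  let E2 := (B ×ˢ (U ∩ A)).filter fun e => T.Adj e.1 e.2
  have hsub : ((B ×ˢ A).filter fun e => T.Adj e.1 e.2) ⊆ E1 ∪ E2 := by
    rintro ⟨b, a⟩ he
    simp only [Finset.mem_filter, Finset.mem_product] at he
    have := hcov b he.1.1 a he.1.2 he.2
    simp only [E1, E2, Finset.mem_union, Finset.mem_filter, Finset.mem_product, Finset.mem_inter]
    tauto
  have hE1 : E1.card ≤ (65 * s) * (59 * s) := by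
    have : E1.card ≤ (U ∩ B).card * (59 * s) := by
      simp only [E1]
      rw [Finset.card_filter, Finset.sum_product, ← smul_eq_mul]
      apply Finset.sum_le_card_nsmul
      intro x hx
      rw [← Finset.card_filter]
      exact hst1 x (Finset.mem_inter.1 hx).2
    exact this.trans (Nat.mul_le_mul_right _
      ((Finset.card_le_card Finset.inter_subset_left).trans hU))
  have hE2 : E2.card ≤ (65 * s) * (59 * s) := by
    have : E2.card ≤ (U ∩ A).card * (59 * s) := by
      simp only [E2]
      rw [Finset.card_filter, Finset.sum_product_right, ← smul_eq_mul]
      apply Finset.sum_le_card_nsmul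
      intro x hx
      rw [← Finset.card_filter]
      exact hst2 x (Finset.mem_inter.1 hx).2
    exact this.trans (Nat.mul_le_mul_right _
      ((Finset.card_le_card Finset.inter_subset_left).trans hU))
  have h1 := (Finset.card_le_card hsub).trans (Finset.card_union_le _ _)
  nlinarith

lemma exists_degree_ordering (T : Digr V) :
    ∃ σ : V → ℕ, IsOrdering σ ∧ ∀ u v, σ u < σ v → od T v ≤ od T u := by
  let e := Fintype.equivFin V
  let f : Fin (Fintype.card V) → ℕᵒᵈ := fun i => OrderDual.toDual (od T (e.symm i))
  let τ := Tuple.sort f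
  have hτ : Monotone (f ∘ τ) := Tuple.monotone_sort f
  refine ⟨fun v => (τ.symm (e v) : ℕ) + 1, ⟨?_, ?_, ?_⟩, ?_⟩
  · intro v _
    simp only [Set.mem_Icc]
    have := (τ.symm (e v)).2
    omega
  · intro u _ v _ h
    simp only [Nat.add_right_cancel_iff] at h
    exact e.injective (τ.symm.injective (Fin.ext h))
  · intro i hi
    rw [Set.mem_Icc] at hi
    refine ⟨e.symm (τ ⟨i - 1, by omega⟩), Set.mem_univ _, ?_⟩
    simp
    omega
  · intro u v h
    have h' : τ.symm (e u) ≤ τ.symm (e v) := by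
      rw [Fin.le_def]
      have h3 : (τ.symm (e u) : ℕ) + 1 < (τ.symm (e v) : ℕ) + 1 := h
      omega
    have h2 := hτ h'
    simp only [Function.comp, Equiv.apply_symm_apply, f, Equiv.symm_apply_apply] at h2
    exact h2

end Core

lemma listArcs_length (l : List V) : (listArcs l).length ≤ l.length - 1 := by
  simp [listArcs]

/-- Greedy routing inside a jungle. -/
lemma greedy {VH : Type} {T : Digr V} {s : ℕ} (φ : VH → V)
    (hφ : ∀ u v, Link T s (φ u) (φ v)) (S : Finset (VH × VH)) (hS : 4 * S.card ≤ s) :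
    ∃ P : VH × VH → List V, (∀ e ∈ S, (P e).IsChain T.Adj ∧ (P e).Nodup ∧
      (P e).head? = some (φ e.1) ∧ (P e).getLast? = some (φ e.2) ∧ (P e).length ≤ 5) ∧
      ∀ e ∈ S, ∀ e' ∈ S, e ≠ e' → ∀ x ∈ listArcs (P e), x ∉ listArcs (P e') := by
  induction S using Finset.induction_on with
  | empty => exact ⟨fun _ => [], by simp, by simp⟩
  | insert e S he ih =>
    rw [Finset.card_insert_of_notMem he] at hS
    obtain ⟨P, hP, hd⟩ := ih (by omega)
    let F : Finset (V × V) := S.biUnion fun e' => (listArcs (P e')).toFinset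
    have hF : F.card ≤ s := by
      have h1 : F.card ≤ S.card * 4 := by
        apply Finset.card_biUnion_le_card_mul
        intro e' he'
        have h2 := (hP e' he').2.2.2.2
        have h3 := List.toFinset_card_le (listArcs (P e'))
        have h4 := listArcs_length (P e')
        omega
      omega
    obtain ⟨l, hc, hn, hh, hl, hlen⟩ := Wk.exists_path 4 _ _ (hφ e.1 e.2 F hF)
    have hav := listArcs_mem_of_chain l hc
    have hnew : ∀ x ∈ listArcs l, ∀ e' ∈ S, x ∉ listArcs (P e') := by
      intro x hx e' he' hx'
      exact (hav x hx).2 (Finset.mem_biUnion.2 ⟨e', he', by simpa using hx'⟩)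
    have hne : ∀ e' ∈ S, e' ≠ e := by
      rintro e' he' rfl; exact he he'
    refine ⟨Function.update P e l, ?_, ?_⟩
    · intro e' he'
      rcases Finset.mem_insert.1 he' with rfl | he'
      · rw [Function.update_self]
        exact ⟨hc.imp fun _ _ h => h.1, hn, hh, hl, hlen⟩
      · rw [Function.update_of_ne (hne e' he')]
        exact hP e' he'
    · intro e₁ h₁ e₂ h₂ h x hx
      rcases Finset.mem_insert.1 h₁ with rfl | g₁
      · rcases Finset.mem_insert.1 h₂ with rfl | g₂
        · exact absurd rfl h
        · rw [Function.update_self] at hx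
          rw [Function.update_of_ne (hne e₂ g₂)]
          exact hnew x hx e₂ g₂
      · rw [Function.update_of_ne (hne e₁ g₁)] at hx
        rcases Finset.mem_insert.1 h₂ with rfl | g₂
        · rw [Function.update_self]
          intro hx'
          exact hnew x hx' e₁ g₁ hx
        · rw [Function.update_of_ne (hne e₂ g₂)]
          exact hd e₁ g₁ e₂ g₂ h x hx

lemma hasImm_of_jungle {VH : Type} [Fintype VH] {H : Digr VH} {T : Digr V} {s : ℕ}
    (X : Finset V) (hX : Fintype.card VH ≤ X.card) (hL : ∀ u ∈ X, ∀ v ∈ X, Link T s u v)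
    (hs : 4 * H.arcs.ncard ≤ s) : HasImm H T := by
  have hcard : Fintype.card VH ≤ Fintype.card X := by simpa using hX
  obtain ⟨f⟩ := Function.Embedding.nonempty_of_card_le hcard
  let φ : VH → V := fun u => (f u : V)
  let S : Finset (VH × VH) := Finset.univ.filter fun e => H.Adj e.1 e.2
  have hSc : S.card = H.arcs.ncard := by
    rw [← Set.ncard_coe_finset]
    congr 1
    ext e
    simp [S, Digr.arcs]
  obtain ⟨P, hP, hd⟩ := greedy (T := T) (s := s) φ
    (fun u v => hL _ (f u).2 _ (f v).2) S (by omega)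
  have hmem : ∀ e : VH × VH, H.Adj e.1 e.2 → e ∈ S := fun e he => by simp [S, he]
  exact ⟨{
    vmap := φ
    inj := fun u v h => f.injective (Subtype.ext h)
    path := fun e _ => P e
    chain := fun e he => (hP e (hmem e he)).1
    nodup := fun e he => (hP e (hmem e he)).2.1
    head := fun e he => (hP e (hmem e he)).2.2.1
    last := fun e he => (hP e (hmem e he)).2.2.2.1
    arc_disj := fun e he e' he' h => hd e (hmem e he) e' (hmem e' he') h }⟩

/-- there is a universal constant `C` such that every tournament
excluding a simple digraph `H` as an immersion has cutwidth at most
`C·(|V(H)| + |A(H)|)²`. -/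
theorem ctw_le_of_immersion_free :
    ∃ C : ℕ, ∀ (VH V : Type) [Fintype VH] [Fintype V] (H : Digr VH) (T : Digr V),
      T.IsTournament → ¬ HasImm H T →
      ctw T ≤ C * (Fintype.card VH + H.arcs.ncard) ^ 2 := by
  refine ⟨7670 * 16, ?_⟩
  intro VH V _ _ H T hT hno
  obtain ⟨σ, hσ, hdeg⟩ := exists_degree_ordering T
  have h1 : ctw T ≤ width T σ := Nat.sInf_le ⟨σ, hσ, rfl⟩
  refine h1.trans (Finset.sup_le ?_)
  intro γ _
  by_contra! hcut
  have hpos : 1 ≤ Fintype.card VH := by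
    by_contra! h
    have h0 : Fintype.card VH = 0 := by omega
    have : IsEmpty VH := Fintype.card_eq_zero_iff.1 h0
    exact hno ⟨{
      vmap := fun u => isEmptyElim u
      inj := fun u => isEmptyElim u
      path := fun e _ => isEmptyElim e.1
      chain := fun e _ => isEmptyElim e.1
      nodup := fun e _ => isEmptyElim e.1
      head := fun e _ => isEmptyElim e.1
      last := fun e _ => isEmptyElim e.1
      arc_disj := fun e _ => isEmptyElim e.1 }⟩
  set h := Fintype.card VH + H.arcs.ncard with hh
  let A : Finset V := Finset.univ.filter fun v => σ v ≤ γ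
  let B : Finset V := Finset.univ.filter fun v => γ < σ v
  have hAB : ∀ a ∈ A, ∀ b ∈ B, od T b ≤ od T a := by
    intro a ha b hb
    have ha' := (Finset.mem_filter.1 ha).2
    have hb' := (Finset.mem_filter.1 hb).2
    exact hdeg a b (by omega)
  have hcard : (cutAt T σ γ).ncard = ((B ×ˢ A).filter fun e => T.Adj e.1 e.2).card := by
    rw [← Set.ncard_coe_finset]
    congr 1
    ext e
    simp [cutAt, A, B]
    tauto
  obtain ⟨X, hX, hL⟩ := core hT (s := 4 * h) (α := B.sup (od T)) (by omega) A B
    (fun a ha => Finset.sup_le fun b hb => hAB a ha b hb)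
    (fun b hb => Finset.le_sup (f := od T) hb)
    (by rw [← hcard]; calc 7670 * (4 * h) ^ 2 = 7670 * 16 * h ^ 2 := by ring
          _ < _ := hcut)
  exact hno (hasImm_of_jungle X (by omega) hL (by omega))

end TournamentPaper
end

section
/- For every simple digraph H without isolated vertices there exists a constant c₀ such that for every positive integer k, every tournament T that does not contain k pairwise arc-disjoint immersion models of H satisfies ctw(T) ≤ c₀·k². -/
namespace TournamentPaper

open Classical

variable {V : Type}

inductive RP {V : Type} (R : V → V → Prop) : ℕ → V → V → Prop
  | refl (n : ℕ) (x : V) : RP R n x x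
  | step {n : ℕ} {x y z : V} : R x y → RP R n y z → RP R (n + 1) x z

lemma RP.toList {V : Type} {R : V → V → Prop} {n : ℕ} {x y : V} (h : RP R n x y) :
    ∃ l : List V, l.IsChain R ∧ l.Nodup ∧ l.head? = some x ∧ l.getLast? = some y ∧
      l.length ≤ n + 1 := by
  induction h with
  | refl n x => exact ⟨[x], by simp, by simp, by simp, by simp, by simp⟩
  | @step n x y z hxy _ ih =>
    obtain ⟨l, hc, hn, hh, hl, hlen⟩ := ih
    by_cases hx : x ∈ l
    · obtain ⟨s, t, rfl⟩ := List.append_of_mem hx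
      refine ⟨x :: t, hc.right_of_append, hn.of_append_right, by simp, ?_, ?_⟩
      · simpa using hl
      · simp at hlen ⊢; omega
    · refine ⟨x :: l, ?_, List.nodup_cons.2 ⟨hx, hn⟩, by simp, ?_, by simpa using hlen⟩
      · rw [List.isChain_cons]
        refine ⟨?_, hc⟩
        intro w hw
        rw [hh] at hw
        simp at hw
        subst hw
        exact hxy
      · cases l with
        | nil => simp at hh
        | cons a l => simpa using hl

lemma chain_listArcs {V : Type} {R : V → V → Prop} {l : List V} (h : l.IsChain R) :
    ∀ e ∈ listArcs l, R e.1 e.2 := by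
  induction l with
  | nil => simp [listArcs]
  | cons a l ih =>
    cases l with
    | nil => simp [listArcs]
    | cons b l =>
      rw [List.isChain_cons_cons] at h
      intro e he
      simp only [listArcs, List.tail_cons, List.zip_cons_cons, List.mem_cons] at he
      rcases he with rfl | he
      · exact h.1
      · exact ih h.2 e (by simpa [listArcs] using he)

/-- Robust short linkage. -/
def Lk (T : Digr V) (q : ℕ) (x y : V) : Prop :=
  ∀ F : Finset (V × V), F.card < q → RP (fun u v => T.Adj u v ∧ (u, v) ∉ F) 4 x y

lemma route {ι : Type} (T : Digr V) (q : ℕ) (src tgt : ι → V)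
    (hL : ∀ i, Lk T q (src i) (tgt i)) (S : Finset ι) (hS : 4 * S.card ≤ q) :
    ∃ p : ι → List V, ∀ i ∈ S, ((p i).IsChain T.Adj ∧ (p i).Nodup ∧
      (p i).head? = some (src i) ∧ (p i).getLast? = some (tgt i) ∧ (p i).length ≤ 5) ∧
      ∀ j ∈ S, i ≠ j → ∀ x ∈ listArcs (p i), x ∉ listArcs (p j) := by
  induction S using Finset.induction_on with
  | empty => exact ⟨fun _ => [], by simp⟩
  | insert a S ha ih =>
    rw [Finset.card_insert_of_notMem ha] at hS
    obtain ⟨p, hp⟩ := ih (by omega)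
    let F : Finset (V × V) := S.biUnion fun i => (listArcs (p i)).toFinset
    have hF : F.card ≤ S.card * 4 := by
      refine Finset.card_biUnion_le_card_mul _ _ _ ?_
      intro i hi
      refine (List.toFinset_card_le _).trans ?_
      have := (hp i hi).1.2.2.2.2
      simp [listArcs]
      omega
    obtain ⟨l, hc, hn, hh, hl, hlen⟩ := (hL a F (by omega)).toList
    have hav : ∀ e ∈ listArcs l, ∀ j ∈ S, e ∉ listArcs (p j) := by
      intro e he j hj hej
      refine (chain_listArcs hc e he).2 ?_
      simp only [F, Finset.mem_biUnion, List.mem_toFinset]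
      exact ⟨j, hj, hej⟩
    have hne : ∀ i ∈ S, i ≠ a := fun i hi h => ha (h ▸ hi)
    refine ⟨Function.update p a l, ?_⟩
    intro i hi
    rcases Finset.mem_insert.1 hi with rfl | hiS
    · refine ⟨?_, ?_⟩
      · simp only [Function.update_self]
        exact ⟨hc.imp fun _ _ h => h.1, hn, hh, hl, hlen⟩
      · intro j hj hij
        rcases Finset.mem_insert.1 hj with rfl | hj
        · exact absurd rfl hij
        · simp only [Function.update_self, Function.update_of_ne (hne j hj)]
          exact fun x hx => hav x hx j hj
    · refine ⟨?_, ?_⟩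
      · simp only [Function.update_of_ne (hne i hiS)]
        exact (hp i hiS).1
      · intro j hj hij
        rcases Finset.mem_insert.1 hj with rfl | hj
        · simp only [Function.update_self, Function.update_of_ne (hne i hiS)]
          exact fun x hx hx' => hav x hx' i hiS hx
        · simp only [Function.update_of_ne (hne i hiS), Function.update_of_ne (hne j hj)]
          exact (hp i hiS).2 j hj hij

lemma packing {VH : Type} [Fintype VH] (H : Digr VH) (T : Digr V) (k : ℕ) (X : Finset V)
    (hX : X.card = Fintype.card VH)
    (hL : ∀ x ∈ X, ∀ y ∈ X, x ≠ y → Lk T (4 * (k * (Fintype.card VH) ^ 2)) x y) :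
    ∃ M : Fin k → ImmersionModel H T, ArcDisjointModels M := by
  have e : VH ≃ X := Fintype.equivOfCardEq (by simp [hX])
  let ι := Fin k × {e : VH × VH // H.Adj e.1 e.2}
  have hcard : Fintype.card ι ≤ k * (Fintype.card VH) ^ 2 := by
    simp only [ι, Fintype.card_prod, Fintype.card_fin]
    refine Nat.mul_le_mul_left _ ?_
    refine (Fintype.card_subtype_le _).trans ?_
    simp [sq]
  obtain ⟨p, hp⟩ := route (ι := ι) T (4 * (k * (Fintype.card VH) ^ 2))
    (fun i => e i.2.1.1) (fun i => e i.2.1.2)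
    (by
      intro i
      refine hL _ (e _).2 _ (e _).2 ?_
      intro h
      have h2 : i.2.1.1 = i.2.1.2 := e.injective (Subtype.ext h)
      have h3 := i.2.2
      rw [h2] at h3
      exact H.loopless _ h3) Finset.univ
    (by rw [Finset.card_univ]; omega)
  refine ⟨fun i =>
    { vmap := fun v => e v
      inj := fun a b h => e.injective (Subtype.ext h)
      path := fun a ha => p (i, ⟨a, ha⟩)
      chain := fun a ha => (hp (i, ⟨a, ha⟩) (Finset.mem_univ _)).1.1
      nodup := fun a ha => (hp (i, ⟨a, ha⟩) (Finset.mem_univ _)).1.2.1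
      head := fun a ha => (hp (i, ⟨a, ha⟩) (Finset.mem_univ _)).1.2.2.1
      last := fun a ha => (hp (i, ⟨a, ha⟩) (Finset.mem_univ _)).1.2.2.2.1
      arc_disj := fun a ha b hb hab => (hp (i, ⟨a, ha⟩) (Finset.mem_univ _)).2 _
        (Finset.mem_univ _) (by
          intro h
          exact hab (congrArg (fun z : ι => z.2.1) h)) }, ?_⟩
  intro i j hij
  rw [Set.disjoint_left]
  rintro x ⟨a, ha, hxa⟩ ⟨b, hb, hxb⟩
  refine (hp (i, ⟨a, ha⟩) (Finset.mem_univ _)).2 (j, ⟨b, hb⟩) (Finset.mem_univ _) ?_ x hxa hxb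
  intro h
  exact hij (congrArg Prod.fst h)

lemma pick {ι α : Type} (W : Finset ι) (F : Finset α) (g : ι → α → Prop)
    (hc : F.card < W.card)
    (hg : ∀ i ∈ W, ∀ j ∈ W, ∀ e, g i e → g j e → i = j) :
    ∃ i ∈ W, ∀ e, g i e → e ∉ F := by
  by_contra! hcon
  have hpos : 0 < W.card := by omega
  obtain ⟨i0, hi0⟩ := Finset.card_pos.1 hpos
  obtain ⟨e0, _⟩ := hcon i0 hi0
  have : Nonempty α := ⟨e0⟩
  choose! f hf using hcon
  refine absurd hc (not_lt.2 (Finset.card_le_card_of_injOn f (fun i hi => (hf i hi).2) ?_))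
  intro i hi j hj hij
  have h2 := (hf j hj).1
  rw [← hij] at h2
  exact hg i hi j hj _ (hf i hi).1 h2

lemma twoStep (T : Digr V) (q : ℕ) (x y : V) (W : Finset V) (hq : q ≤ W.card)
    (hW : ∀ w ∈ W, T.Adj x w ∧ T.Adj w y) (F : Finset (V × V)) (hF : F.card < q) :
    ∃ w, (T.Adj x w ∧ (x, w) ∉ F) ∧ (T.Adj w y ∧ (w, y) ∉ F) := by
  obtain ⟨w, hw, h⟩ := pick W F (fun w e => e = (x, w) ∨ e = (w, y)) (by omega) (by
    intro i hi j hj e h1 h2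
    have hxi : x ≠ i := by
      rintro rfl; exact T.loopless _ (hW _ hi).1
    have hxj : x ≠ j := by
      rintro rfl; exact T.loopless _ (hW _ hj).1
    rcases h1 with rfl | rfl <;> rcases h2 with h2 | h2 <;> simp at h2 <;> grind)
  exact ⟨w, ⟨(hW w hw).1, h _ (Or.inl rfl)⟩, ⟨(hW w hw).2, h _ (Or.inr rfl)⟩⟩

lemma low_card (r : V → V → Prop) (hr : ∀ u v, u ≠ v → r u v ∨ r v u) (R : Finset V) (q : ℕ)
    (h : ∀ v ∈ R, (R.filter fun u => r u v).card < q) : R.card ≤ 2 * q := by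
  have h1 := Finset.sum_card_bipartiteAbove_eq_sum_card_bipartiteBelow (s := R) (t := R) r
  have h2 : ∑ v ∈ R, (R.filter fun u => r u v).card ≤ R.card * (q - 1) := by
    rw [← smul_eq_mul]
    exact Finset.sum_le_card_nsmul _ _ _ fun v hv => by have := h v hv; omega
  have h3 : R.card * (R.card - 1) ≤
      ∑ v ∈ R, ((R.filter fun u => r u v).card + (R.filter fun u => r v u).card) := by
    rw [← smul_eq_mul]
    refine Finset.card_nsmul_le_sum _ _ _ fun v hv => ?_
    rw [← Finset.card_erase_of_mem hv]
    refine (Finset.card_le_card ?_).trans (Finset.card_union_le _ _)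
    intro u hu
    simp only [Finset.mem_erase] at hu
    simp only [Finset.mem_union, Finset.mem_filter]
    rcases hr u v hu.1 with h | h
    · exact Or.inl ⟨hu.2, h⟩
    · exact Or.inr ⟨hu.2, h⟩
  rw [Finset.sum_add_distrib] at h3
  simp only [Finset.bipartiteAbove, Finset.bipartiteBelow] at h1
  rw [h1] at h3
  rcases Nat.eq_zero_or_pos R.card with h0 | h0
  · omega
  · have h4 : R.card * (R.card - 1) ≤ R.card * (2 * (q - 1)) := by
      calc _ ≤ _ := h3
        _ ≤ R.card * (q - 1) + R.card * (q - 1) := add_le_add h2 h2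
        _ = _ := by ring
    obtain ⟨v, hv⟩ := Finset.card_pos.1 h0
    have h6 := h v hv
    have h5 := Nat.le_of_mul_le_mul_left h4 h0
    omega

lemma high_deg (r : V → V → Prop) (hr : ∀ u v, u ≠ v → r u v ∨ r v u) (S : Finset V) (q h : ℕ)
    (hS : 2 * q + h ≤ S.card) :
    ∃ X ⊆ S, X.card = h ∧ ∀ v ∈ X, q ≤ (S.filter fun u => r u v).card := by
  let R := S.filter fun v => (S.filter fun u => r u v).card < q
  have hR : R.card ≤ 2 * q := by
    refine low_card r hr R q ?_
    intro v hv
    refine lt_of_le_of_lt (Finset.card_le_card ?_) (Finset.mem_filter.1 hv).2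
    exact Finset.filter_subset_filter _ (Finset.filter_subset _ _)
  have h1 := Finset.card_filter_add_card_filter_not (s := S)
    (fun v => (S.filter fun u => r u v).card < q)
  obtain ⟨X, hX, hXc⟩ := Finset.exists_subset_card_eq
    (s := S.filter fun v => ¬ (S.filter fun u => r u v).card < q) (n := h)
    (by simp only [R] at hR; omega)
  refine ⟨X, hX.trans (Finset.filter_subset _ _), hXc, ?_⟩
  intro v hv
  have := (Finset.mem_filter.1 (hX hv)).2
  omega

/-- If `d⁺(y) ≤ d⁺(x)`, `y → x`, and `q` outneighbours of `y` are not outneighbours of `x`,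
then there are `q` two-step paths from `x` to `y`. -/
lemma swapDeg [Fintype V] (T : Digr V) (hT : T.IsTournament) (q : ℕ) (x y : V)
    (hyx : T.Adj y x) (hd : T.outdeg y ≤ T.outdeg x) (W : Finset V) (hq : q ≤ W.card)
    (hW : ∀ w ∈ W, T.Adj y w ∧ ¬ T.Adj x w) :
    ∃ W' : Finset V, q ≤ W'.card ∧ ∀ w ∈ W', T.Adj x w ∧ T.Adj w y := by
  have hne : x ≠ y := by rintro rfl; exact T.loopless _ hyx
  let A : Finset V := Finset.univ.filter fun v => T.Adj x v
  let B : Finset V := Finset.univ.filter fun v => T.Adj y v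
  have hA : T.outdeg x = A.card := by
    simp [Digr.outdeg, A, Set.ncard_eq_toFinset_card']
  have hB : T.outdeg y = B.card := by
    simp [Digr.outdeg, B, Set.ncard_eq_toFinset_card']
  have h1 : W ⊆ B \ A := by
    intro w hw
    simp [A, B, hW w hw]
  have h2 := Finset.card_le_card h1
  have h3 := Finset.card_sdiff_add_card_inter B A
  have h4 := Finset.card_sdiff_add_card_inter A B
  rw [Finset.inter_comm] at h4
  refine ⟨A \ B, by omega, ?_⟩
  intro w hw
  simp only [A, B, Finset.mem_sdiff, Finset.mem_filter, Finset.mem_univ, true_and] at hw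
  refine ⟨hw.1, ?_⟩
  have hwy : w ≠ y := by
    rintro rfl
    exact (hT _ _ hne).1 hw.1 hyx
  exact (hT _ _ hwy).2 hw.2

/-- Linkage via a hub. -/
lemma hubLk (T : Digr V) (q : ℕ) (x b y : V) (W W' : Finset V) (hq : q ≤ W.card)
    (hq' : q ≤ W'.card)
    (hW : ∀ w ∈ W, T.Adj x w ∧ T.Adj w b) (hW' : ∀ w ∈ W', T.Adj b w ∧ T.Adj w y) :
    Lk T q x y := by
  intro F hF
  obtain ⟨w, h1, h2⟩ := twoStep T q x b W hq hW F hF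
  obtain ⟨w', h3, h4⟩ := twoStep T q b y W' hq' hW' F hF
  exact RP.step h1 (RP.step h2 (RP.step h3 (RP.step h4 (RP.refl 0 y))))

lemma tour_or {T : Digr V} (hT : T.IsTournament) (u v : V) (h : u ≠ v) :
    T.Adj u v ∨ T.Adj v u := by
  have := hT u v h
  tauto

lemma tour_asymm {T : Digr V} (hT : T.IsTournament) {u v : V} (h : T.Adj u v) :
    ¬ T.Adj v u := by
  have hne : u ≠ v := by rintro rfl; exact T.loopless _ h
  exact (hT u v hne).1 h

/-- Star with centre `b` in the later part. -/
lemma starOut [Fintype V] (T : Digr V) (hT : T.IsTournament) (q h : ℕ) (b : V) (S : Finset V)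
    (hS : 2 * q + h ≤ S.card) (hb : ∀ a ∈ S, T.Adj b a ∧ T.outdeg b ≤ T.outdeg a) :
    ∃ X : Finset V, X.card = h ∧ ∀ x ∈ X, ∀ y ∈ X, x ≠ y → Lk T q x y := by
  obtain ⟨X, hXS, hXc, hX⟩ := high_deg T.Adj (tour_or hT) S q h hS
  refine ⟨X, hXc, ?_⟩
  intro x hx y hy _
  obtain ⟨W, hWc, hW⟩ := swapDeg T hT q x b (hb x (hXS hx)).1 (hb x (hXS hx)).2
    _ (hX x hx) (by
      intro w hw
      rw [Finset.mem_filter] at hw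
      exact ⟨(hb w hw.1).1, tour_asymm hT hw.2⟩)
  refine hubLk T q x b y W _ hWc (hX y hy) hW ?_
  intro w hw
  rw [Finset.mem_filter] at hw
  exact ⟨(hb w hw.1).1, hw.2⟩

/-- Star with centre `a` in the earlier part. -/
lemma starIn [Fintype V] (T : Digr V) (hT : T.IsTournament) (q h : ℕ) (a : V) (S : Finset V)
    (hS : 2 * q + h ≤ S.card) (ha : ∀ b ∈ S, T.Adj b a ∧ T.outdeg b ≤ T.outdeg a) :
    ∃ X : Finset V, X.card = h ∧ ∀ x ∈ X, ∀ y ∈ X, x ≠ y → Lk T q x y := by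
  obtain ⟨X, hXS, hXc, hX⟩ := high_deg (fun u v => T.Adj v u)
    (fun u v h => tour_or hT v u h.symm) S q h hS
  refine ⟨X, hXc, ?_⟩
  intro x hx y hy _
  obtain ⟨W, hWc, hW⟩ := swapDeg T hT q a y (ha y (hXS hy)).1 (ha y (hXS hy)).2
    _ (hX y hy) (by
      intro w hw
      rw [Finset.mem_filter] at hw
      exact ⟨hw.2, tour_asymm hT (ha w hw.1).1⟩)
  refine hubLk T q x a y _ W (hX x hx) hWc ?_ hW
  intro w hw
  rw [Finset.mem_filter] at hw
  exact ⟨hw.2, (ha w hw.1).1⟩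

lemma matching (E : Finset (V × V)) (K : ℕ)
    (h1 : ∀ v, (E.filter fun e => e.1 = v).card ≤ K)
    (h2 : ∀ v, (E.filter fun e => e.2 = v).card ≤ K) (s : ℕ) (hs : 2 * K * s < E.card) :
    ∃ M ⊆ E, M.card = s ∧ (∀ e ∈ M, ∀ f ∈ M, e.1 = f.1 → e = f) ∧
      (∀ e ∈ M, ∀ f ∈ M, e.2 = f.2 → e = f) := by
  induction s with
  | zero => exact ⟨∅, by simp, by simp, by simp, by simp⟩
  | succ s ih =>
    obtain ⟨M, hME, hMc, hM1, hM2⟩ := ih (by nlinarith)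
    let N := M.biUnion fun f => (E.filter fun e => e.1 = f.1) ∪ (E.filter fun e => e.2 = f.2)
    have hN : N.card ≤ M.card * (2 * K) := by
      refine Finset.card_biUnion_le_card_mul _ _ _ fun f _ => ?_
      refine (Finset.card_union_le _ _).trans ?_
      have := h1 f.1
      have := h2 f.2
      omega
    obtain ⟨e, heE, heN⟩ : ∃ e ∈ E, e ∉ N := by
      by_contra! hcon
      have := Finset.card_le_card (show E ⊆ N from hcon)
      rw [hMc] at hN
      nlinarith
    have hav : ∀ f ∈ M, e.1 ≠ f.1 ∧ e.2 ≠ f.2 := by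
      intro f hf
      constructor
      · intro h
        exact heN (Finset.mem_biUnion.2 ⟨f, hf, Finset.mem_union_left _
          (Finset.mem_filter.2 ⟨heE, h⟩)⟩)
      · intro h
        exact heN (Finset.mem_biUnion.2 ⟨f, hf, Finset.mem_union_right _
          (Finset.mem_filter.2 ⟨heE, h⟩)⟩)
    have heM : e ∉ M := fun h => (hav e h).1 rfl
    refine ⟨insert e M, Finset.insert_subset heE hME, by
      rw [Finset.card_insert_of_notMem heM, hMc], ?_, ?_⟩
    · intro a ha b hb hab
      rcases Finset.mem_insert.1 ha with rfl | ha1 <;>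
        rcases Finset.mem_insert.1 hb with rfl | hb1
      · rfl
      · exact absurd hab (hav b hb1).1
      · exact absurd hab.symm (hav a ha1).1
      · exact hM1 a ha1 b hb1 hab
    · intro a ha b hb hab
      rcases Finset.mem_insert.1 ha with rfl | ha1 <;>
        rcases Finset.mem_insert.1 hb with rfl | hb1
      · rfl
      · exact absurd hab (hav b hb1).2
      · exact absurd hab.symm (hav a ha1).2
      · exact hM2 a ha1 b hb1 hab

/-- The matching case. -/
lemma matchCase (T : Digr V) (hT : T.IsTournament) (q h K : ℕ) (P : V → Prop)
    (M : Finset (V × V)) (hM : ∀ e ∈ M, T.Adj e.1 e.2 ∧ ¬ P e.1 ∧ P e.2)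
    (hM1 : ∀ e ∈ M, ∀ f ∈ M, e.1 = f.1 → e = f) (hM2 : ∀ e ∈ M, ∀ f ∈ M, e.2 = f.2 → e = f)
    (hK : ∀ a, P a → (M.filter fun e => T.Adj e.1 a).card ≤ K)
    (hs : 2 * (K + q) + h ≤ M.card) :
    ∃ X : Finset V, X.card = h ∧ ∀ x ∈ X, ∀ y ∈ X, x ≠ y → Lk T q x y := by
  have hSc : (M.image Prod.snd).card = M.card :=
    Finset.card_image_of_injOn fun e he f hf => hM2 e he f hf
  obtain ⟨X, hXS, hXc, hX⟩ := high_deg T.Adj (tour_or hT) (M.image Prod.snd) (K + q) h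
    (by omega)
  have hXP : ∀ x ∈ X, P x := by
    intro x hx
    obtain ⟨e, he, rfl⟩ := Finset.mem_image.1 (hXS hx)
    exact (hM e he).2.2
  refine ⟨X, hXc, ?_⟩
  intro x hx y hy _ F hF
  have hPx := hXP x hx
  have hPy := hXP y hy
  have h1 : K + q ≤ (M.filter fun e => T.Adj e.2 y).card := by
    refine (hX y hy).trans ?_
    rw [Finset.filter_image]
    exact Finset.card_image_le
  have h2 := hK x hPx
  let W := (M.filter fun e => T.Adj e.2 y) \ (M.filter fun e => T.Adj e.1 x)
  have hWc : q ≤ W.card := by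
    have := Finset.le_card_sdiff (M.filter fun e => T.Adj e.1 x) (M.filter fun e => T.Adj e.2 y)
    simp only [W]
    omega
  have hW : ∀ e ∈ W, e ∈ M ∧ T.Adj x e.1 ∧ T.Adj e.2 y := by
    intro e he
    simp only [W, Finset.mem_sdiff, Finset.mem_filter, not_and] at he
    refine ⟨he.1.1, ?_, he.1.2⟩
    have hne : x ≠ e.1 := by
      intro h
      exact (hM e he.1.1).2.1 (h ▸ hPx)
    exact (hT _ _ hne).2 (he.2 he.1.1)
  obtain ⟨e, heW, he⟩ := pick W F
    (fun e a => a = (x, e.1) ∨ a = e ∨ a = (e.2, y)) (by omega) (by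
    intro e he f hf a ha hb
    have he' := hM e (hW e he).1
    have hf' := hM f (hW f hf).1
    have k1 := hM1 e (hW e he).1 f (hW f hf).1
    have k2 := hM2 e (hW e he).1 f (hW f hf).1
    obtain ⟨e1, e2⟩ := e
    obtain ⟨f1, f2⟩ := f
    obtain ⟨a1, a2⟩ := a
    simp only [Prod.mk.injEq] at *
    grind)
  obtain ⟨heM, hxe, hey⟩ := hW e heW
  exact RP.step ⟨hxe, he _ (Or.inl rfl)⟩ (RP.step ⟨(hM e heM).1, he _ (Or.inr (Or.inl rfl))⟩
    (RP.step ⟨hey, he _ (Or.inr (Or.inr rfl))⟩ (RP.refl 1 y)))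

lemma exists_ordering [Fintype V] (f : V → ℕ) :
    ∃ σ : V → ℕ, IsOrdering σ ∧ ∀ u v, σ u ≤ σ v → f v ≤ f u := by
  let e := Fintype.equivFin V
  let g : Fin (Fintype.card V) → ℕᵒᵈ := fun i => OrderDual.toDual (f (e.symm i))
  let τ := Tuple.sort g
  have hm : Monotone (g ∘ τ) := Tuple.monotone_sort g
  refine ⟨fun v => (τ.symm (e v) : ℕ) + 1, ⟨?_, ?_, ?_⟩, ?_⟩
  · intro v _
    have := (τ.symm (e v)).2
    simp only [Set.mem_Icc]
    omega
  · intro u _ v _ h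
    have h' : (τ.symm (e u) : ℕ) = (τ.symm (e v) : ℕ) := by simpa using h
    exact e.injective (τ.symm.injective (Fin.ext h'))
  · intro i hi
    simp only [Set.mem_Icc] at hi
    refine ⟨e.symm (τ ⟨i - 1, by omega⟩), trivial, ?_⟩
    simp
    omega
  · intro u v h
    have h' : τ.symm (e u) ≤ τ.symm (e v) := by
      rw [Fin.le_def]; simpa using h
    have := hm h'
    simpa [g] using this

lemma core_s7 [Fintype V] (T : Digr V) (hT : T.IsTournament) (q h : ℕ)
    (hno : ¬ ∃ X : Finset V, X.card = h ∧ ∀ x ∈ X, ∀ y ∈ X, x ≠ y → Lk T q x y) :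
    ctw T ≤ 2 * (2 * q + h) * (2 * ((2 * q + h) + q) + h) := by
  obtain ⟨σ, hσ, hmono⟩ := exists_ordering T.outdeg
  have hle : ctw T ≤ width T σ := Nat.sInf_le ⟨σ, hσ, rfl⟩
  refine hle.trans ?_
  refine Finset.sup_le fun γ _ => ?_
  by_contra! hcut
  let E : Finset (V × V) := Finset.univ.filter fun e => e ∈ cutAt T σ γ
  have hE : (cutAt T σ γ).ncard = E.card := by
    rw [← Set.ncard_coe_finset]
    congr 1
    ext e
    simp [E]
  rw [hE] at hcut
  have hEm : ∀ e ∈ E, T.Adj e.1 e.2 ∧ γ < σ e.1 ∧ σ e.2 ≤ γ := by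
    intro e he
    exact (Finset.mem_filter.1 he).2
  have hin : ∀ a, σ a ≤ γ →
      (Finset.univ.filter fun b => T.Adj b a ∧ γ < σ b).card ≤ 2 * q + h := by
    intro a ha
    by_contra! hc
    refine hno (starIn T hT q h a _ hc.le ?_)
    intro b hb
    simp only [Finset.mem_filter, Finset.mem_univ, true_and] at hb
    exact ⟨hb.1, hmono _ _ (by omega)⟩
  have hout : ∀ b, γ < σ b →
      (Finset.univ.filter fun a => T.Adj b a ∧ σ a ≤ γ).card ≤ 2 * q + h := by
    intro b hb
    by_contra! hc
    refine hno (starOut T hT q h b _ hc.le ?_)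
    intro a ha
    simp only [Finset.mem_filter, Finset.mem_univ, true_and] at ha
    exact ⟨ha.1, hmono _ _ (by omega)⟩
  obtain ⟨M, hME, hMc, hM1, hM2⟩ := matching E (2 * q + h) (by
      intro v
      by_cases hv : γ < σ v
      · refine le_trans (Finset.card_le_card_of_injOn Prod.snd ?_ ?_) (hout v hv)
        · intro e he
          obtain ⟨he1, rfl⟩ := Finset.mem_filter.1 he
          have := hEm e he1
          simp [this]
        · intro e he f hf hef
          have h1 := (Finset.mem_filter.1 he).2
          have h2 := (Finset.mem_filter.1 hf).2
          exact Prod.ext (h1.trans h2.symm) hef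
      · rw [Finset.filter_eq_empty_iff.2]
        · simp
        · rintro e he rfl
          exact hv (hEm e he).2.1) (by
      intro v
      by_cases hv : σ v ≤ γ
      · refine le_trans (Finset.card_le_card_of_injOn Prod.fst ?_ ?_) (hin v hv)
        · intro e he
          obtain ⟨he1, rfl⟩ := Finset.mem_filter.1 he
          have := hEm e he1
          simp [this]
        · intro e he f hf hef
          have h1 := (Finset.mem_filter.1 he).2
          have h2 := (Finset.mem_filter.1 hf).2
          exact Prod.ext hef (h1.trans h2.symm)
      · rw [Finset.filter_eq_empty_iff.2]
        · simp
        · rintro e he rfl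
          exact hv (hEm e he).2.2) _ hcut
  refine hno (matchCase T hT q h (2 * q + h) (fun v => σ v ≤ γ) M ?_ hM1 hM2 ?_ hMc.ge)
  · intro e he
    have := hEm e (hME he)
    exact ⟨this.1, not_le.2 this.2.1, this.2.2⟩
  · intro a ha
    refine le_trans (Finset.card_le_card_of_injOn Prod.fst ?_ ?_) (hin a ha)
    · intro e he
      obtain ⟨he1, he2⟩ := Finset.mem_filter.1 he
      have := hEm e (hME he1)
      simp [this, he2]
    · intro e he f hf hef
      exact hM1 e (Finset.mem_filter.1 he).1 f (Finset.mem_filter.1 hf).1 hef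

/-- for every simple digraph `H` without isolated vertices there is a
constant `c₀` such that every tournament with no `k` pairwise arc-disjoint immersion
models of `H` has cutwidth at most `c₀·k²`. -/
theorem ctw_le_of_no_packing
    {VH : Type} [Fintype VH] (H : Digr VH)
    (hiso : ∀ v : VH, ∃ u : VH, H.Adj v u ∨ H.Adj u v) :
    ∃ c₀ : ℕ, ∀ k : ℕ, 0 < k → ∀ (V : Type) [Fintype V] (T : Digr V),
      T.IsTournament →
      ¬ (∃ M : Fin k → ImmersionModel H T, ArcDisjointModels M) →
      ctw T ≤ c₀ * k ^ 2 := by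
  have _ := hiso
  let h := Fintype.card VH
  refine ⟨2 * (8 * h ^ 2 + h) * (24 * h ^ 2 + 3 * h), ?_⟩
  intro k hk V _ T hT hno
  refine (core_s7 T hT (4 * (k * h ^ 2)) h ?_).trans ?_
  · rintro ⟨X, hXc, hX⟩
    exact hno (packing H T k X hXc hX)
  · have hh : h ≤ h * k := Nat.le_mul_of_pos_right _ hk
    calc _ ≤ 2 * (2 * (4 * (k * h ^ 2)) + h * k) *
          (2 * ((2 * (4 * (k * h ^ 2)) + h * k) + 4 * (k * h ^ 2)) + h * k) := by gcongr
      _ = _ := by ring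

end TournamentPaper
end
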